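/- There exists an absolute constant c > 0 with the following property. Let p be an odd prime, let W be a real Hilbert space, w₀ ∈ W, and let f and g be as in the context. Suppose D ≥ 0 satisfies (1/(p−1)) · Σ_{x ∈ (ZMod p)ˣ} ‖g(x)‖² ≤ D². Let s : ℝ → ℝ be differentiable and 1-Lipschitz, and for each a ∈ (ZMod p)ˣ define the classification-loss objective L_a : W → ℝ by L_a(w) = (1/(p−1)) · Σ_{x ∈ (ZMod p)ˣ} s(f(w)(x) · h_a(x)). Then, writing ∇L_a(w₀) for the gradient of L_a at w₀ and μ = (1/(p−1)) · Σ_{a ∈ (ZMod p)ˣ} ∇L_a(w₀), one has (1/(p−1)) · Σ_{a ∈ (ZMod p)ˣ} ‖∇L_a(w₀) − μ‖² ≤ c · D² · (ln p)/√p. -/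

import Mathlib

open Finset in
theorem norm_sum_smul_sq_le {ι E : Type*} [NormedAddCommGroup E] [NormedSpace ℝ E]
    (t : Finset ι) (c : ι → ℝ) (v : ι → E) :
    ‖∑ k ∈ t, c k • v k‖ ^ 2 ≤ (∑ k ∈ t, |c k|) * ∑ k ∈ t, |c k| * ‖v k‖ ^ 2 := by
  have h : ‖∑ k ∈ t, c k • v k‖ ≤ ∑ k ∈ t, |c k| * ‖v k‖ :=
    (norm_sum_le _ _).trans_eq (sum_congr rfl fun k _ => by rw [norm_smul, Real.norm_eq_abs])
  calc ‖∑ k ∈ t, c k • v k‖ ^ 2 ≤ (∑ k ∈ t, |c k| * ‖v k‖) ^ 2 := by gcongr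
    _ ≤ _ := sum_sq_le_sum_mul_sum_of_sq_le_mul _ (fun _ _ => by positivity)
        (fun _ _ => by positivity) fun k _ => le_of_eq (by ring)

/-- The kernel `cos (2πx/N) + sin (2πx/N)` of the discrete Hartley transform. -/
noncomputable def ZMod.cas {N : ℕ} [NeZero N] (x : ZMod N) : ℝ :=
  (stdAddChar x).re + (stdAddChar x).im

theorem ZMod.cas_mul_cas {N : ℕ} [NeZero N] (x y : ZMod N) :
    cas x * cas y = (stdAddChar (x - y)).re + (stdAddChar (x + y)).im := by
  simp only [cas, sub_eq_add_neg, AddChar.map_add_eq_mul, AddChar.map_neg_eq_conj,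
    Complex.mul_re, Complex.mul_im, Complex.conj_re, Complex.conj_im]
  ring

theorem ZMod.sum_cas_mul_cas {N : ℕ} [NeZero N] (x y : ZMod N) :
    ∑ k, cas (k * x) * cas (k * y) = if x = y then (N : ℝ) else 0 := by
  simp only [cas_mul_cas, ← mul_sub, ← mul_add, Finset.sum_add_distrib, ← Complex.re_sum,
    ← Complex.im_sum, AddChar.sum_mulShift _ (isPrimitive_stdAddChar N), sub_eq_zero, card]
  split_ifs <;> simp

/-- Plancherel's identity for the Hartley transform with values in an inner product space. -/
theorem ZMod.sum_norm_sq_sum_cas_smul {N : ℕ} [NeZero N] {ι E : Type*} [Fintype ι]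
    [NormedAddCommGroup E] [InnerProductSpace ℝ E] (e : ι → ZMod N) (he : e.Injective)
    (u : ι → E) :
    ∑ k, ‖∑ x, cas (k * e x) • u x‖ ^ 2 = N * ∑ x, ‖u x‖ ^ 2 := by
  classical
  have h (k : ZMod N) : ‖∑ x, cas (k * e x) • u x‖ ^ 2 =
      ∑ x, ∑ y, (cas (k * e x) * cas (k * e y)) * inner ℝ (u x) (u y) := by
    rw [← real_inner_self_eq_norm_sq, sum_inner]
    simp_rw [inner_sum, real_inner_smul_left, real_inner_smul_right, mul_assoc]
  simp_rw [h]
  rw [Finset.sum_comm, Finset.mul_sum]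
  refine Finset.sum_congr rfl fun x _ => ?_
  rw [Finset.sum_comm]
  simp_rw [← Finset.sum_mul, sum_cas_mul_cas, he.eq_iff]
  simp

/-- The parity sign `(-1) ^ z.val`, set to zero at `z = 0`. -/
noncomputable def ZMod.paritySign {N : ℕ} (z : ZMod N) : ℝ :=
  if z = 0 then 0 else (-1) ^ z.val

/-- The Hartley coefficients of `ZMod.paritySign`. -/
noncomputable def ZMod.parityCoeff {N : ℕ} [NeZero N] (k : ZMod N) : ℝ :=
  (∑ z, paritySign z * cas (k * z)) / N

theorem ZMod.paritySign_eq_sum {N : ℕ} [NeZero N] (z : ZMod N) :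
    paritySign z = ∑ k, parityCoeff k * cas (k * z) := by
  have hN : (N : ℝ) ≠ 0 := NeZero.ne _
  simp_rw [parityCoeff, div_mul_eq_mul_div, ← Finset.sum_div, Finset.sum_mul]
  rw [Finset.sum_comm]
  simp_rw [mul_assoc, ← Finset.mul_sum, sum_cas_mul_cas]
  simp [hN]

theorem ZMod.sum_univ_eq_sum_range {N : ℕ} [NeZero N] {M : Type*} [AddCommMonoid M]
    (F : ZMod N → M) : ∑ z, F z = ∑ n ∈ Finset.range N, F n :=
  Finset.sum_bij' (fun z _ => z.val) (fun n _ => (n : ZMod N))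
    (fun z _ => Finset.mem_range.2 z.val_lt) (fun _ _ => Finset.mem_univ _)
    (fun z _ => natCast_zmod_val z)
    (fun n hn => val_cast_of_lt (Finset.mem_range.1 hn))
    (fun z _ => by rw [natCast_zmod_val])

theorem ZMod.one_add_stdAddChar_mul_sum {N : ℕ} [NeZero N] (hN : Odd N) (k : ZMod N) :
    (1 + stdAddChar k) * (∑ z, (paritySign z : ℂ) * stdAddChar (k * z) + 1) = 2 := by
  have h : ∑ z, (paritySign z : ℂ) * stdAddChar (k * z) + 1 =
      ∑ n ∈ Finset.range N, (-stdAddChar k) ^ n := by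
    have h₀ : (1 : ℂ) = ∑ z : ZMod N, if z = 0 then 1 else 0 := by simp
    conv_lhs => rw [h₀, ← Finset.sum_add_distrib]
    rw [sum_univ_eq_sum_range]
    refine Finset.sum_congr rfl fun n hn => ?_
    have hn' := Finset.mem_range.1 hn
    rw [neg_pow, ← AddChar.map_nsmul_eq_pow, nsmul_eq_mul, mul_comm (n : ZMod N)]
    by_cases hz : (n : ZMod N) = 0
    · have : n = 0 := by
        have := val_cast_of_lt hn'
        rw [hz, val_zero] at this
        exact this.symm
      simp [this, paritySign]
    · simp [paritySign, hz, val_cast_of_lt hn']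
  have hp : stdAddChar k ^ N = 1 := by
    rw [← AddChar.map_nsmul_eq_pow]; simp
  have := mul_neg_geom_sum (-stdAddChar k) N
  rw [sub_neg_eq_add] at this
  rw [h, this, hN.neg_pow, hp]
  norm_num

theorem ZMod.le_norm_one_add_stdAddChar {N : ℕ} [NeZero N] (k : ZMod N) :
    2 * |(N : ℝ) - 2 * k.val| / N ≤ ‖1 + stdAddChar k‖ := by
  have hN : (0 : ℝ) < N := Nat.cast_pos.2 (NeZero.pos N)
  have hk : (k.val : ℝ) ≤ N := by exact_mod_cast k.val_lt.le
  have hk₀ : (0 : ℝ) ≤ k.val := by positivity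
  set y : ℝ := Real.pi * (2 * k.val - N) / (2 * N) with hy
  have hexp : ‖1 + stdAddChar k‖ = ‖Complex.exp (Complex.I * ((2 * y : ℝ) : ℂ)) - 1‖ := by
    rw [← norm_neg, stdAddChar_apply, toCircle_apply]
    congr 1
    have : Complex.I * ((2 * y : ℝ) : ℂ) =
        2 * Real.pi * Complex.I * k.val / N - Real.pi * Complex.I := by
      have : (N : ℂ) ≠ 0 := NeZero.ne _
      rw [hy]; push_cast; field_simp
    rw [this, Complex.exp_sub, Complex.exp_pi_mul_I]
    ring
  have habs : |y| = Real.pi / 2 * (|(N : ℝ) - 2 * k.val| / N) := by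
    rw [hy, abs_div, abs_mul, abs_of_pos Real.pi_pos, abs_of_pos (by positivity : 0 < 2 * (N : ℝ)),
      abs_sub_comm]
    field_simp
  have hle : |(N : ℝ) - 2 * k.val| / N ≤ 1 := by
    rw [div_le_one hN, abs_le]; constructor <;> linarith
  have := Real.mul_abs_le_abs_sin (x := y) (by
    rw [habs]; exact mul_le_of_le_one_right (by positivity) hle)
  rw [hexp, Complex.norm_exp_I_mul_ofReal_sub_one, mul_div_cancel_left₀ _ two_ne_zero, norm_mul,
    Real.norm_eq_abs, Real.norm_eq_abs, abs_two]
  rw [habs, ← mul_assoc, div_mul_div_cancel₀ Real.pi_ne_zero, div_self two_ne_zero, one_mul] at this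
  rw [mul_div_assoc]
  linarith

theorem ZMod.abs_parityCoeff_le {N : ℕ} [NeZero N] (hN : Odd N) (k : ZMod N) :
    |parityCoeff k| ≤ 4 * |(N : ℝ) - 2 * k.val|⁻¹ := by
  have hpos : (0 : ℝ) < N := Nat.cast_pos.2 (NeZero.pos N)
  set S : ℂ := ∑ z, (paritySign z : ℂ) * stdAddChar (k * z) with hS
  have hcoeff : parityCoeff k = (S.re + S.im) / N := by
    simp only [parityCoeff, hS, Complex.re_sum, Complex.im_sum, ← Finset.sum_add_distrib,
      Complex.re_ofReal_mul, Complex.im_ofReal_mul, cas, mul_add]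
  have hmul : ‖1 + stdAddChar k‖ * ‖S + 1‖ = 2 := by
    rw [← norm_mul, one_add_stdAddChar_mul_sum hN]; simp
  have hle : ‖1 + stdAddChar k‖ ≤ 2 := by
    refine (norm_add_le _ _).trans ?_
    rw [AddChar.norm_apply, norm_one]; norm_num
  have hone : 1 ≤ ‖S + 1‖ := by nlinarith [norm_nonneg (S + 1)]
  have hSle : ‖S‖ ≤ 2 * ‖S + 1‖ := by
    have := norm_sub_le (S + 1) 1
    rw [add_sub_cancel_right, norm_one] at this
    linarith
  have hd : 0 < |(N : ℝ) - 2 * k.val| := by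
    refine abs_pos.2 fun h => ?_
    have h' : N = 2 * k.val := by exact_mod_cast sub_eq_zero.1 h
    exact Nat.not_even_iff_odd.2 hN (h' ▸ even_two_mul _)
  have hlow := le_norm_one_add_stdAddChar k
  have hS1 : |(N : ℝ) - 2 * k.val| / N * ‖S + 1‖ ≤ 1 := by
    rw [mul_div_assoc] at hlow
    nlinarith [norm_nonneg (S + 1)]
  have habs : |S.re + S.im| ≤ 2 * ‖S‖ :=
    (abs_add_le _ _).trans (by linarith [Complex.abs_re_le_norm S, Complex.abs_im_le_norm S])
  rw [hcoeff, abs_div, abs_of_pos hpos, ← div_eq_mul_inv, div_le_div_iff₀ hpos hd]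
  rw [div_mul_eq_mul_div, div_le_one hpos] at hS1
  nlinarith

theorem sum_range_inv_two_mul_add_one_le (m : ℕ) :
    ∑ j ∈ Finset.range m, (2 * (j : ℝ) + 1)⁻¹ ≤ 1 + Real.log m := by
  refine le_trans ?_ (harmonic_le_one_add_log m)
  rw [harmonic]
  push_cast
  gcongr
  linarith

theorem sum_range_inv_abs_sub_le (m : ℕ) (hm : 1 ≤ m) :
    ∑ k ∈ Finset.range (2 * m + 1), |((2 * m + 1 : ℕ) : ℝ) - 2 * k|⁻¹ ≤
      4 * Real.log (2 * m + 1 : ℕ) := by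
  have hm' : (1 : ℝ) ≤ m := by exact_mod_cast hm
  have h₁ : ∑ k ∈ Finset.range (m + 1), |((2 * m + 1 : ℕ) : ℝ) - 2 * k|⁻¹ =
      ∑ j ∈ Finset.range (m + 1), (2 * (j : ℝ) + 1)⁻¹ := by
    rw [← Finset.sum_range_reflect]
    refine Finset.sum_congr rfl fun j hj => ?_
    have : j ≤ m := Nat.lt_succ_iff.1 (Finset.mem_range.1 hj)
    rw [Nat.add_sub_cancel, Nat.cast_sub this]
    congr 1
    push_cast
    rw [abs_of_nonneg] <;> linarith [(Nat.cast_nonneg j : (0 : ℝ) ≤ j)]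
  have h₂ : ∑ k ∈ Finset.range m, |((2 * m + 1 : ℕ) : ℝ) - 2 * (m + 1 + k : ℕ)|⁻¹ =
      ∑ j ∈ Finset.range m, (2 * (j : ℝ) + 1)⁻¹ := by
    refine Finset.sum_congr rfl fun j _ => ?_
    congr 1
    push_cast
    rw [abs_of_nonpos] <;> linarith [(Nat.cast_nonneg j : (0 : ℝ) ≤ j)]
  have hlog : 1 ≤ Real.log (2 * m + 1 : ℕ) := by
    rw [Real.le_log_iff_exp_le (by positivity)]
    push_cast
    linarith [Real.exp_one_lt_three]
  have hl₁ : Real.log (m + 1 : ℕ) ≤ Real.log (2 * m + 1 : ℕ) := by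
    gcongr; omega
  have hl₂ : Real.log m ≤ Real.log (2 * m + 1 : ℕ) := by
    gcongr; omega
  rw [show 2 * m + 1 = m + 1 + m by ring, Finset.sum_range_add,
    show m + 1 + m = 2 * m + 1 by ring, h₁, h₂]
  linarith [sum_range_inv_two_mul_add_one_le m, sum_range_inv_two_mul_add_one_le (m + 1)]

theorem ZMod.sum_abs_parityCoeff_le {N : ℕ} [NeZero N] (hN : Odd N) (h1 : 1 < N) :
    ∑ k : ZMod N, |parityCoeff k| ≤ 16 * Real.log N := by
  refine (Finset.sum_le_sum fun k _ => abs_parityCoeff_le hN k).trans ?_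
  rw [← Finset.mul_sum, sum_univ_eq_sum_range]
  have : ∑ n ∈ Finset.range N, |(N : ℝ) - 2 * (n : ZMod N).val|⁻¹ =
      ∑ n ∈ Finset.range N, |(N : ℝ) - 2 * n|⁻¹ :=
    Finset.sum_congr rfl fun n hn => by rw [val_cast_of_lt (Finset.mem_range.1 hn)]
  rw [this]
  obtain ⟨m, rfl⟩ := hN
  linarith [sum_range_inv_abs_sub_le m (by omega)]

theorem ZMod.sum_paritySign {N : ℕ} [NeZero N] (hN : Odd N) :
    ∑ z : ZMod N, paritySign z = 0 := by
  have := one_add_stdAddChar_mul_sum hN (0 : ZMod N)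
  simp only [zero_mul, AddChar.map_zero_eq_one, mul_one] at this
  have h : (((∑ z : ZMod N, paritySign z : ℝ)) : ℂ) = 0 := by
    push_cast
    linear_combination this / 2
  exact_mod_cast h

theorem ZMod.parityCoeff_zero {N : ℕ} [NeZero N] (hN : Odd N) :
    parityCoeff (0 : ZMod N) = 0 := by
  simp [parityCoeff, cas, sum_paritySign hN]

theorem ZMod.paritySign_unit {p : ℕ} [Fact p.Prime] (x : (ZMod p)ˣ) :
    paritySign (x : ZMod p) = (-1) ^ (x : ZMod p).val := by
  simp [paritySign]

theorem ZMod.sum_units_neg_one_pow_val {p : ℕ} [Fact p.Prime] (hp : Odd p) :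
    ∑ x : (ZMod p)ˣ, (-1 : ℝ) ^ (x : ZMod p).val = 0 := by
  rw [← sum_paritySign (N := p) hp]
  simp_rw [← paritySign_unit]
  refine Finset.sum_of_injOn (fun x : (ZMod p)ˣ => (x : ZMod p)) Units.val_injective.injOn
    (by simp) (fun z _ hz => ?_) (fun _ _ => rfl)
  by_cases h : z = 0
  · simp [paritySign, h]
  · exact absurd ⟨Units.mk0 z h, by simp⟩ hz

/-- Operator norm bound for the matrix of parity signs `(-1) ^ (a⁻¹ x).val`. -/
theorem ZMod.sum_norm_sq_sum_parity_smul_le {p : ℕ} [Fact p.Prime] (hp : Odd p) {E : Type*}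
    [NormedAddCommGroup E] [InnerProductSpace ℝ E] (u : (ZMod p)ˣ → E) :
    ∑ a : (ZMod p)ˣ, ‖∑ x : (ZMod p)ˣ, (-1 : ℝ) ^ ((a⁻¹ * x : (ZMod p)ˣ) : ZMod p).val • u x‖ ^ 2 ≤
      (16 * Real.log p) ^ 2 * (p * ∑ x, ‖u x‖ ^ 2) := by
  set v : ZMod p → E := fun k => ∑ x : (ZMod p)ˣ, cas (k * (x : ZMod p)) • u x with hv
  have hexp (a : (ZMod p)ˣ) :
      ∑ x : (ZMod p)ˣ, (-1 : ℝ) ^ ((a⁻¹ * x : (ZMod p)ˣ) : ZMod p).val • u x =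
        ∑ k : ZMod p, parityCoeff k • v (k * (a⁻¹ : (ZMod p)ˣ)) := by
    simp_rw [hv, Finset.smul_sum, smul_smul]
    rw [Finset.sum_comm]
    refine Finset.sum_congr rfl fun x _ => ?_
    rw [← paritySign_unit, paritySign_eq_sum, Finset.sum_smul, Units.val_mul]
    simp_rw [mul_assoc]
  have hk (k : ZMod p) (hk : k ≠ 0) :
      ∑ a : (ZMod p)ˣ, ‖v (k * (a⁻¹ : (ZMod p)ˣ))‖ ^ 2 ≤ p * ∑ x, ‖u x‖ ^ 2 := by
    rw [← sum_norm_sq_sum_cas_smul (fun x : (ZMod p)ˣ => (x : ZMod p)) Units.val_injective u]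
    have hinj : Function.Injective fun a : (ZMod p)ˣ => k * ((a⁻¹ : (ZMod p)ˣ) : ZMod p) :=
      fun a b h => inv_injective (Units.ext (mul_left_cancel₀ hk h))
    rw [← Finset.sum_image (f := fun y => ‖v y‖ ^ 2) hinj.injOn]
    exact Finset.sum_le_sum_of_subset_of_nonneg (Finset.subset_univ _) fun _ _ _ => by positivity
  have hC := sum_abs_parityCoeff_le hp (Fact.out : p.Prime).one_lt
  have hC₀ : 0 ≤ ∑ k : ZMod p, |parityCoeff k| := by positivity
  simp_rw [hexp]
  calc _ ≤ ∑ a : (ZMod p)ˣ, (∑ k : ZMod p, |parityCoeff k|) *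
        ∑ k : ZMod p, |parityCoeff k| * ‖v (k * (a⁻¹ : (ZMod p)ˣ))‖ ^ 2 :=
        Finset.sum_le_sum fun a _ => norm_sum_smul_sq_le _ _ _
    _ = (∑ k : ZMod p, |parityCoeff k|) *
        ∑ k : ZMod p, |parityCoeff k| * ∑ a : (ZMod p)ˣ, ‖v (k * (a⁻¹ : (ZMod p)ˣ))‖ ^ 2 := by
        rw [← Finset.mul_sum, Finset.sum_comm]
        congr! 2
        rw [Finset.mul_sum]
    _ ≤ (∑ k : ZMod p, |parityCoeff k|) *
        ∑ k : ZMod p, |parityCoeff k| * (p * ∑ x, ‖u x‖ ^ 2) := by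
        refine mul_le_mul_of_nonneg_left (Finset.sum_le_sum fun k _ => ?_) hC₀
        by_cases h : k = 0
        · rw [h, parityCoeff_zero hp, abs_zero, zero_mul, zero_mul]
        · exact mul_le_mul_of_nonneg_left (hk k h) (abs_nonneg _)
    _ ≤ _ := by
        rw [← Finset.sum_mul, ← mul_assoc, ← sq]
        gcongr

theorem hasGradientAt_classification_loss {ι W : Type*} [Fintype ι] [NormedAddCommGroup W]
    [InnerProductSpace ℝ W] [CompleteSpace W] {w₀ : W} {f : W → ι → ℝ}
    (hf : ∀ x, DifferentiableAt ℝ (fun w => f w x) w₀) {s : ℝ → ℝ} (hs : Differentiable ℝ s)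
    (r : ℝ) (h : ι → ℝ) :
    HasGradientAt (fun w => r * ∑ x, s (f w x * h x))
      (r • ∑ x, (deriv s (f w₀ x * h x) * h x) • gradient (fun w => f w x) w₀) w₀ := by
  rw [hasGradientAt_iff_hasFDerivAt]
  have h₁ (x : ι) : HasFDerivAt (fun w => s (f w x * h x))
      (deriv s (f w₀ x * h x) • h x • InnerProductSpace.toDual ℝ W (gradient (fun w => f w x) w₀))
      w₀ :=
    (hs _).hasDerivAt.comp_hasFDerivAt w₀ ((hf x).hasGradientAt.hasFDerivAt.mul_const (h x))
  have h₂ := (HasFDerivAt.fun_sum fun x (_ : x ∈ Finset.univ) => h₁ x).const_mul r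
  refine h₂.congr_fderiv ?_
  simp [map_sum, smul_smul]

theorem deriv_mul_sign_eq (s : ℝ → ℝ) (t : ℝ) {ε : ℝ} (hε : ε = 1 ∨ ε = -1) :
    deriv s (t * ε) * ε =
      (deriv s t - deriv s (-t)) / 2 + ε * ((deriv s t + deriv s (-t)) / 2) := by
  rcases hε with rfl | rfl <;> simp <;> ring

theorem Real.log_le_two_mul_sqrt {x : ℝ} (hx : 0 < x) : Real.log x ≤ 2 * √x := by
  have h := Real.log_le_sub_one_of_pos (Real.sqrt_pos.2 hx)
  rw [Real.log_sqrt hx.le] at h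
  linarith


/-- There is an absolute constant `c > 0` with the following property. Let `p` be an odd
prime, `W` a real Hilbert space, `w₀ ∈ W`, and `f : W → (ZMod p)ˣ → ℝ` with each
`w ↦ f(w)(x)` differentiable at `w₀`, with gradient `g(x)` there. If
`(1/(p-1)) · Σ_x ‖g(x)‖² ≤ D²`, and `s : ℝ → ℝ` is differentiable and 1-Lipschitz, then
for the classification-loss objectives
`L_a(w) = (1/(p-1)) · Σ_x s(f(w)(x) · h_a(x))` (with
`h_a(x) = (-1)^((a⁻¹·x).val)` the parity bit of the discrete logarithm of `x` to base `a`
in `(ZMod p, +)`), the variance of the gradient satisfies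
`(1/(p-1)) · Σ_a ‖∇L_a(w₀) − μ‖² ≤ c · D² · ln p / √p`, where
`μ = (1/(p-1)) · Σ_a ∇L_a(w₀)`. -/
theorem gradient_concentration_classification_loss :
    ∃ c : ℝ, 0 < c ∧
      ∀ (p : ℕ) [Fact (Nat.Prime p)], Odd p →
        ∀ (W : Type) [NormedAddCommGroup W] [InnerProductSpace ℝ W] [CompleteSpace W]
          (w₀ : W) (f : W → (ZMod p)ˣ → ℝ),
          (∀ x : (ZMod p)ˣ, DifferentiableAt ℝ (fun w => f w x) w₀) →
          ∀ D : ℝ, 0 ≤ D →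
            (1 / ((p : ℝ) - 1)) *
                ∑ x : (ZMod p)ˣ, ‖gradient (fun w => f w x) w₀‖ ^ 2 ≤ D ^ 2 →
            ∀ s : ℝ → ℝ, Differentiable ℝ s → LipschitzWith 1 s →
              (1 / ((p : ℝ) - 1)) *
                  ∑ a : (ZMod p)ˣ,
                    ‖gradient
                          (fun w =>
                            (1 / ((p : ℝ) - 1)) *
                              ∑ x : (ZMod p)ˣ,
                                s (f w x *
                                    (-1 : ℝ) ^
                                      (((a⁻¹ * x : (ZMod p)ˣ) : ZMod p)).val))
                          w₀ -
                        (1 / ((p : ℝ) - 1)) •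
                          ∑ b : (ZMod p)ˣ,
                            gradient
                              (fun w =>
                                (1 / ((p : ℝ) - 1)) *
                                  ∑ x : (ZMod p)ˣ,
                                    s (f w x *
                                        (-1 : ℝ) ^
                                          (((b⁻¹ * x : (ZMod p)ˣ) : ZMod p)).val))
                              w₀‖ ^ 2 ≤
                c * D ^ 2 * Real.log p / Real.sqrt p := by
  refine ⟨2048, by norm_num, ?_⟩
  intro p _ hp W _ _ _ w₀ f hf D hD hg s hs hLip
  have hp2 : 2 ≤ p := (Fact.out : p.Prime).two_le
  have hpR : (2 : ℝ) ≤ p := by exact_mod_cast hp2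
  set r : ℝ := 1 / ((p : ℝ) - 1) with hr
  have hr₀ : 0 < r := one_div_pos.2 (by linarith)
  have hcard : r * Fintype.card (ZMod p)ˣ = 1 := by
    rw [ZMod.card_units, Nat.cast_sub (by omega), Nat.cast_one, hr]
    exact one_div_mul_cancel (by linarith)
  set g : (ZMod p)ˣ → W := fun x => gradient (fun w => f w x) w₀ with hgdef
  set A : W := r • ∑ x, ((deriv s (f w₀ x) - deriv s (-f w₀ x)) / 2) • g x with hA
  set u : (ZMod p)ˣ → W := fun x => ((deriv s (f w₀ x) + deriv s (-f w₀ x)) / 2) • g x with hu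
  set Φ : (ZMod p)ˣ → W := fun a =>
    ∑ x : (ZMod p)ˣ, (-1 : ℝ) ^ ((a⁻¹ * x : (ZMod p)ˣ) : ZMod p).val • u x with hΦ
  have hgrad (a : (ZMod p)ˣ) : gradient (fun w => r * ∑ x : (ZMod p)ˣ,
      s (f w x * (-1 : ℝ) ^ (((a⁻¹ * x : (ZMod p)ˣ) : ZMod p)).val)) w₀ = A + r • Φ a := by
    rw [(hasGradientAt_classification_loss hf hs r _).gradient, hA, hΦ, ← smul_add,
      ← Finset.sum_add_distrib]
    congr 1
    refine Finset.sum_congr rfl fun x _ => ?_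
    rw [deriv_mul_sign_eq _ _ (neg_one_pow_eq_or ℝ _), add_smul, hu, smul_smul]
  have hsum : ∑ a, Φ a = 0 := by
    rw [hΦ, Finset.sum_comm]
    refine Finset.sum_eq_zero fun x _ => ?_
    have h := Equiv.sum_comp ((Equiv.inv (ZMod p)ˣ).trans (Equiv.mulRight x))
      fun y : (ZMod p)ˣ => (-1 : ℝ) ^ (y : ZMod p).val
    rw [← Finset.sum_smul]
    exact (congrArg (· • u x) (h.trans (ZMod.sum_units_neg_one_pow_val hp))).trans (zero_smul _ _)
  have hmean : r • ∑ a, (A + r • Φ a) = A := by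
    rw [Finset.sum_add_distrib, ← Finset.smul_sum (f := Φ), hsum, smul_zero, add_zero, Finset.sum_const,
      Finset.card_univ, ← Nat.cast_smul_eq_nsmul ℝ, smul_smul, hcard, one_smul]
  have hu_le (x : (ZMod p)ˣ) : ‖u x‖ ≤ ‖g x‖ := by
    have h₁ := norm_deriv_le_of_lipschitz hLip (x₀ := f w₀ x)
    have h₂ := norm_deriv_le_of_lipschitz hLip (x₀ := -f w₀ x)
    rw [Real.norm_eq_abs, NNReal.coe_one, abs_le] at h₁ h₂
    rw [hu, norm_smul, Real.norm_eq_abs]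
    refine mul_le_of_le_one_left (norm_nonneg _) (abs_le.2 ?_)
    constructor <;> linarith
  have hmain : r * ∑ x, ‖u x‖ ^ 2 ≤ D ^ 2 := by
    refine le_trans ?_ hg
    gcongr with x
    exact hu_le x
  have hop := ZMod.sum_norm_sq_sum_parity_smul_le hp u
  have hlog₀ : 0 ≤ Real.log p := Real.log_nonneg (by linarith)
  have hlog := Real.log_le_two_mul_sqrt (by linarith : (0 : ℝ) < p)
  have hsq : √(p : ℝ) * √p = p := Real.mul_self_sqrt (by linarith)
  have hsqpos : 0 < √(p : ℝ) := Real.sqrt_pos.2 (by linarith)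
  have hrp : r * p ≤ 2 := by
    rw [hr, one_div_mul_eq_div, div_le_iff₀ (by linarith)]
    linarith
  simp_rw [hgrad, hmean, add_sub_cancel_left, norm_smul, mul_pow, ← Finset.mul_sum, Real.norm_eq_abs,
    sq_abs]
  rw [le_div_iff₀ hsqpos]
  calc r * (r ^ 2 * ∑ a, ‖Φ a‖ ^ 2) * √p
      ≤ r * (r ^ 2 * ((16 * Real.log p) ^ 2 * (p * ∑ x, ‖u x‖ ^ 2))) * √p := by gcongr
    _ = 256 * (r * p) ^ 2 * (r * ∑ x, ‖u x‖ ^ 2) * Real.log p * (Real.log p * √p / p) := by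
        field_simp
        ring
    _ ≤ 256 * 2 ^ 2 * D ^ 2 * Real.log p * 2 := by
        gcongr
        rw [div_le_iff₀ (by linarith)]
        nlinarith
    _ = 2048 * D ^ 2 * Real.log p := by ring
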